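/- Let V be an (n+1)-dimensional vector space over an algebraically closed field of characteristic 0, and let H, H' be linear subspaces of S^p V (p ≥ 2, 1 ≤ d ≤ n-d-1) such that the bundle morphisms f_H : S^p R → O_G ⊗ (S^p V / H) and f_{H'} : S^p R → O_G ⊗ (S^p V / H') on G(d,n) are injective, with quotient bundles E_H and E_{H'}. If E_H ≅ E_{H'} as vector bundles, then H = H'. -/

import Mathlib

open scoped TensorProduct PiTensorProduct

variable (K : Type*) [Field K]

/-- The submodule of relations defining the `p`-th symmetric power. -/
noncomputable def symRel (V : Type*) [AddCommGroup V] [Module K V] (p : ℕ) :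
    Submodule K (⨂[K]^p V) :=
  ⨆ σ : Equiv.Perm (Fin p), LinearMap.range
    ((PiTensorProduct.reindex K (fun _ : Fin p => V) σ).toLinearMap - LinearMap.id)

/-- The `p`-th symmetric power of a module. -/
abbrev SymPow (V : Type*) [AddCommGroup V] [Module K V] (p : ℕ) :=
  (⨂[K]^p V) ⧸ symRel K V p

/-- Functoriality of symmetric powers: a linear map `f : V →ₗ W` induces
`S^p f : S^p V →ₗ S^p W`. -/
noncomputable def SymPow.map {V W : Type*} [AddCommGroup V] [Module K V]
    [AddCommGroup W] [Module K W] (p : ℕ) (f : V →ₗ[K] W) :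
    SymPow K V p →ₗ[K] SymPow K W p :=
  Submodule.liftQ _ ((symRel K W p).mkQ ∘ₗ PiTensorProduct.map fun _ : Fin p => f)
    (by
      rw [symRel, iSup_le_iff]
      intro σ
      rintro x ⟨y, rfl⟩
      rw [LinearMap.mem_ker]
      simp only [LinearMap.comp_apply, LinearMap.sub_apply, LinearEquiv.coe_coe,
        LinearMap.id_apply, map_sub, Submodule.mkQ_apply]
      have h := PiTensorProduct.map_reindex (fun _ : Fin p => f) σ y
      rw [h, sub_eq_zero]
      apply (Submodule.Quotient.eq _).2
      refine Submodule.mem_iSup_of_mem σ ⟨PiTensorProduct.map (fun _ : Fin p => f) y, ?_⟩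
      simp)

open Polynomial in
theorem polySolve {K : Type*} [Field K] [IsAlgClosed K] {m q : Type*} [Fintype m] [DecidableEq m]
    [Fintype q] [DecidableEq q] (A : Matrix q m K[X]) (w : q → K[X])
    (hinj : ∀ (t : K) (y : m → K), (A.map (evalRingHom t)).mulVec y = 0 → y = 0)
    (hex : ∀ t : K, ∃ y : m → K, (A.map (evalRingHom t)).mulVec y = evalRingHom t ∘ w) :
    ∃ y : m → K[X], A.mulVec y = w := by
  have hinf : Infinite K := IsAlgClosed.instInfinite
  have step1 : ∃ f : K[X], f ≠ 0 ∧ ∃ y : m → K[X], A.mulVec y = f • w := by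
    obtain ⟨g, hg⟩ := LinearMap.exists_leftInverse_of_injective
      (Matrix.toLin' (A.map (evalRingHom (0 : K)))) (by
        rw [LinearMap.ker_eq_bot']
        intro y hy
        exact hinj 0 y (by simpa using hy))
    set L := LinearMap.toMatrix' g with hL
    have hLA : L * (A.map (evalRingHom (0 : K))) = 1 := by
      have := congrArg LinearMap.toMatrix' hg
      rw [LinearMap.toMatrix'_comp, LinearMap.toMatrix'_toLin', LinearMap.toMatrix'_id] at this
      exact this
    have hLe : ∀ t : K, (L.map (C : K →+* K[X])).map (evalRingHom t) = L := by
      intro t; ext i j; simp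
    set B := L.map (C : K →+* K[X]) * A with hB
    have hBe : ∀ t : K, B.map (evalRingHom t) = L * A.map (evalRingHom t) := by
      intro t; rw [hB, Matrix.map_mul, hLe]
    have hdet : ∀ t : K, evalRingHom t B.det = (L * A.map (evalRingHom t)).det := by
      intro t
      rw [RingHom.map_det, ← hBe]; rfl
    refine ⟨B.det, ?_, B.adjugate.mulVec ((L.map (C : K →+* K[X])).mulVec w), ?_⟩
    · intro h
      have := hdet 0
      rw [h, hLA] at this
      simp at this
    · set y := B.adjugate.mulVec ((L.map (C : K →+* K[X])).mulVec w) with hy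
      have hf0 : B.det ≠ 0 := by
        intro h
        have := hdet 0
        rw [h, hLA] at this
        simp at this
      have hBy : B.mulVec y = B.det • (L.map (C : K →+* K[X])).mulVec w := by
        rw [hy, Matrix.mulVec_mulVec, Matrix.mul_adjugate, Matrix.smul_mulVec, Matrix.one_mulVec]
      have key : ∀ t : K, evalRingHom t B.det ≠ 0 →
          ∀ i, evalRingHom t (A.mulVec y i) = evalRingHom t ((B.det • w) i) := by
        intro t ht i
        obtain ⟨u, hu⟩ := hex t
        have h1 : (L * A.map (evalRingHom t)).mulVec (evalRingHom t ∘ y)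
            = (L * A.map (evalRingHom t)).mulVec ((evalRingHom t B.det) • u) := by
          rw [← hBe t, Matrix.mulVec_smul]
          ext j
          have h2 := congrArg (evalRingHom t) (congrFun hBy j)
          rw [RingHom.map_mulVec] at h2
          rw [h2, Pi.smul_apply, smul_eq_mul, map_mul, RingHom.map_mulVec, Pi.smul_apply,
            smul_eq_mul, hLe, hBe, ← Matrix.mulVec_mulVec, hu]
        have h3 : evalRingHom t ∘ y = (evalRingHom t B.det) • u := by
          apply Matrix.mulVec_injective_of_isUnit _ h1
          rw [Matrix.isUnit_iff_isUnit_det, ← hdet]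
          exact isUnit_iff_ne_zero.mpr ht
        rw [RingHom.map_mulVec, h3, Matrix.mulVec_smul, hu]
        simp
      ext1 i
      apply mul_right_cancel₀ hf0
      apply Polynomial.funext
      intro t
      by_cases ht : evalRingHom t B.det = 0
      · simp only [coe_evalRingHom] at ht
        simp [ht]
      · have := key t ht i
        simp only [coe_evalRingHom] at this
        rw [eval_mul, eval_mul, this]
  obtain ⟨f, hf, y, hy⟩ := step1
  induction hn : f.natDegree generalizing f y with
  | zero =>
    obtain ⟨c, rfl⟩ := natDegree_eq_zero.mp hn
    have hc : c ≠ 0 := by rintro rfl; simp at hf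
    refine ⟨C c⁻¹ • y, ?_⟩
    rw [Matrix.mulVec_smul, hy, smul_smul, ← C_mul, inv_mul_cancel₀ hc]
    simp
  | succ k ih =>
    obtain ⟨r, hr⟩ := IsAlgClosed.exists_root f (by
      rw [degree_eq_natDegree hf, hn]; exact_mod_cast Nat.succ_ne_zero k)
    have hyr : evalRingHom r ∘ y = 0 := by
      apply hinj r
      ext i
      rw [← RingHom.map_mulVec, hy]
      have : eval r f = 0 := hr
      simp [this]
    have hdvd : ∀ j, ∃ z, y j = (X - C r) * z := by
      intro j
      have : (X - C r) ∣ y j := dvd_iff_isRoot.mpr (by simpa using congrFun hyr j)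
      exact this
    choose z hz using hdvd
    obtain ⟨f', rfl⟩ : (X - C r) ∣ f := dvd_iff_isRoot.mpr hr
    have hf' : f' ≠ 0 := right_ne_zero_of_mul hf
    refine ih f' hf' z ?_ ?_
    · have hyz : y = (X - C r) • z := by ext1 j; exact hz j
      rw [hyz, Matrix.mulVec_smul, mul_smul] at hy
      ext1 i
      exact mul_left_cancel₀ (X_sub_C_ne_zero r) (congrFun hy i)
    · rw [natDegree_mul (X_sub_C_ne_zero r) hf', natDegree_X_sub_C] at hn
      omega

open Polynomial in
theorem polyConst {K : Type*} [Field K] {m q : Type*} [Fintype m]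
    (A : Matrix q m K[X]) (w : q → K[X]) (p : ℕ)
    (hA : ∀ i j, (A i j).natDegree ≤ p) (hw : ∀ i, (w i).natDegree ≤ p)
    (hinj : ∀ y : m → K, (A.map (fun f => f.coeff p)).mulVec y = 0 → y = 0)
    (y : m → K[X]) (hy : A.mulVec y = w) : ∀ j, (y j).natDegree = 0 := by
  set e := Finset.univ.sup (fun j => (y j).natDegree) with he
  have hle : ∀ j, (y j).natDegree ≤ e := fun j =>
    Finset.le_sup (f := fun j => (y j).natDegree) (Finset.mem_univ j)
  by_cases h0 : e = 0
  · intro j; have := hle j; omega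
  exfalso
  have hz : (fun j => (y j).coeff e) = 0 := by
    apply hinj
    ext i
    have h1 : (w i).coeff (p + e) = 0 := coeff_eq_zero_of_natDegree_lt (by have := hw i; omega)
    rw [← hy] at h1
    simp only [Matrix.mulVec, dotProduct, finsetSum_coeff] at h1
    simp only [Matrix.mulVec, dotProduct, Matrix.map_apply, Pi.zero_apply]
    rw [← h1]
    refine Finset.sum_congr rfl fun j _ => ?_
    rw [coeff_mul_add_eq_of_natDegree_le (hA i j) (hle j)]
  have hne : (Finset.univ : Finset m).Nonempty := by
    by_contra h
    rw [Finset.not_nonempty_iff_eq_empty] at h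
    rw [h] at he
    simp at he
    exact h0 he
  obtain ⟨j, -, hj⟩ := Finset.exists_mem_eq_sup Finset.univ hne (fun j => (y j).natDegree)
  have h2 := congrFun hz j
  simp only [Pi.zero_apply] at h2
  rw [he, hj, coeff_natDegree, leadingCoeff_eq_zero] at h2
  rw [h2, natDegree_zero] at hj
  exact h0 (he.trans hj)

open Polynomial in
theorem linSolve {K : Type*} [Field K] [IsAlgClosed K] {M Q : Type*} [AddCommGroup M] [Module K M]
    [FiniteDimensional K M] [AddCommGroup Q] [Module K Q] [FiniteDimensional K Q] (p : ℕ)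
    (A : ℕ → (M →ₗ[K] Q)) (w : ℕ → Q)
    (hinj : ∀ t : K, Function.Injective (∑ k ∈ Finset.range (p + 1), t ^ k • A k : M →ₗ[K] Q))
    (hp : Function.Injective (A p))
    (hex : ∀ t : K, ∃ y, (∑ k ∈ Finset.range (p + 1), t ^ k • A k) y =
      ∑ k ∈ Finset.range (p + 1), t ^ k • w k) :
    ∃ y : M, A 0 y = w 0 ∧ A p y = w p := by
  classical
  let b := Module.finBasis K M
  let c := Module.finBasis K Q
  let P : Matrix _ _ K[X] := fun i j =>
    ∑ k ∈ Finset.range (p + 1), C (LinearMap.toMatrix b c (A k) i j) * X ^ k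
  let v : _ → K[X] := fun i => ∑ k ∈ Finset.range (p + 1), C (c.repr (w k) i) * X ^ k
  have hPe : ∀ t : K, P.map (evalRingHom t) =
      LinearMap.toMatrix b c (∑ k ∈ Finset.range (p + 1), t ^ k • A k) := by
    intro t
    ext i j
    rw [Matrix.map_apply]
    simp only [P, coe_evalRingHom, eval_finsetSum, eval_mul, eval_C, eval_pow,
      eval_X, map_sum, map_smul, Matrix.sum_apply, Matrix.smul_apply, smul_eq_mul]
    exact Finset.sum_congr rfl fun k _ => mul_comm _ _
  have hve : ∀ t : K, evalRingHom t ∘ v = c.repr (∑ k ∈ Finset.range (p + 1), t ^ k • w k) := by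
    intro t
    ext i
    simp only [v, Function.comp_apply, coe_evalRingHom, eval_finsetSum, eval_mul, eval_C, eval_pow,
      eval_X, map_sum, map_smul, Finsupp.finsetSum_apply, Finsupp.smul_apply, smul_eq_mul]
    exact Finset.sum_congr rfl fun k _ => mul_comm _ _
  have coeffsum : ∀ (f : ℕ → K) (l : ℕ), l ≤ p →
      (∑ k ∈ Finset.range (p + 1), C (f k) * X ^ k).coeff l = f l := by
    intro f l hl
    simp [coeff_C_mul, coeff_X_pow]
    omega
  have degsum : ∀ (f : ℕ → K),
      (∑ k ∈ Finset.range (p + 1), C (f k) * X ^ k).natDegree ≤ p := by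
    intro f
    refine natDegree_sum_le_of_forall_le _ _ fun k hk => ?_
    exact (natDegree_C_mul_X_pow_le _ _).trans (by simpa [Nat.lt_succ_iff] using hk)
  have hcm : ∀ l ≤ p, P.map (fun f => f.coeff l) = LinearMap.toMatrix b c (A l) := by
    intro l hl
    ext i j
    exact coeffsum (fun k => LinearMap.toMatrix b c (A k) i j) l hl
  have hgen : ∀ (F : M →ₗ[K] Q), Function.Injective F → ∀ y : _ → K,
      (LinearMap.toMatrix b c F).mulVec y = 0 → y = 0 := by
    intro F hF y hy
    have h1 : F (b.equivFun.symm y) = 0 := by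
      apply c.equivFun.injective
      rw [map_zero, ← hy]
      have := LinearMap.toMatrix_mulVec_repr b c F (b.equivFun.symm y)
      rw [← Module.Basis.equivFun_apply, ← Module.Basis.equivFun_apply] at this
      rw [← this, LinearEquiv.apply_symm_apply]
    have h2 := hF (h1.trans (map_zero F).symm)
    exact (LinearEquiv.map_eq_zero_iff _).mp h2
  obtain ⟨y, hy⟩ := polySolve P v
    (fun t y h => hgen _ (hinj t) y (by rw [← hPe]; exact h))
    (fun t => by
      obtain ⟨y, hy⟩ := hex t
      refine ⟨b.repr y, ?_⟩
      rw [hPe, hve, LinearMap.toMatrix_mulVec_repr, hy])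
  have hy0 := polyConst P v p (fun i j => degsum _) (fun i => degsum _)
    (fun y h => hgen _ hp y (by rw [← hcm p le_rfl]; exact h)) y hy
  choose z hz using fun j => natDegree_eq_zero.mp (hy0 j)
  have main : ∀ l ≤ p, A l (b.equivFun.symm z) = w l := by
    intro l hl
    apply c.equivFun.injective
    have := LinearMap.toMatrix_mulVec_repr b c (A l) (b.equivFun.symm z)
    rw [← Module.Basis.equivFun_apply, ← Module.Basis.equivFun_apply] at this
    rw [← this, ← hcm l hl]
    ext i
    have h1 := congrArg (fun f => f.coeff l) (congrFun hy i)
    simp only [Matrix.mulVec, dotProduct, finsetSum_coeff, ← hz, coeff_mul_C] at h1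
    simp only [v] at h1
    rw [coeffsum _ l hl] at h1
    simp only [LinearEquiv.apply_symm_apply, Matrix.mulVec, dotProduct, Matrix.map_apply,
      Module.Basis.equivFun_apply]
    exact h1
  exact ⟨_, main 0 (Nat.zero_le _), main p le_rfl⟩
section SymHelpers

variable {V W U : Type*} [AddCommGroup V] [Module K V] [AddCommGroup W] [Module K W]
  [AddCommGroup U] [Module K U]

theorem SymPow.map_mk (p : ℕ) (f : V →ₗ[K] W) (x : ⨂[K]^p V) :
    SymPow.map K p f ((symRel K V p).mkQ x) =
      (symRel K W p).mkQ (PiTensorProduct.map (fun _ : Fin p => f) x) := rfl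

theorem SymPow.map_comp (p : ℕ) (g : W →ₗ[K] U) (f : V →ₗ[K] W) :
    SymPow.map K p (g ∘ₗ f) = SymPow.map K p g ∘ₗ SymPow.map K p f := by
  refine LinearMap.ext fun x => ?_
  obtain ⟨x, rfl⟩ := (symRel K V p).mkQ_surjective x
  rw [LinearMap.comp_apply, SymPow.map_mk, SymPow.map_mk, SymPow.map_mk,
    PiTensorProduct.map_comp (fun _ : Fin p => g) (fun _ : Fin p => f)]
  rfl

theorem SymPow.map_id (p : ℕ) :
    SymPow.map K p (LinearMap.id : V →ₗ[K] V) = LinearMap.id := by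
  refine LinearMap.ext fun x => ?_
  obtain ⟨x, rfl⟩ := (symRel K V p).mkQ_surjective x
  rw [SymPow.map_mk, PiTensorProduct.map_id]
  rfl

/-- The `p`-th power of a vector in the symmetric power. -/
noncomputable def symPw (p : ℕ) (v : V) : SymPow K V p :=
  (symRel K V p).mkQ (PiTensorProduct.tprod K fun _ : Fin p => v)

theorem SymPow.map_symPw (p : ℕ) (f : V →ₗ[K] W) (v : V) :
    SymPow.map K p f (symPw K p v) = symPw K p (f v) := by
  rw [symPw, SymPow.map_mk, PiTensorProduct.map_tprod]
  rfl

theorem SymPow.map_injective (p : ℕ) (f : V →ₗ[K] W) (hf : Function.Injective f) :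
    Function.Injective (SymPow.map K p f) := by
  obtain ⟨g, hg⟩ := LinearMap.exists_leftInverse_of_injective f (LinearMap.ker_eq_bot.mpr hf)
  have h : SymPow.map K p g ∘ₗ SymPow.map K p f = LinearMap.id := by
    rw [← SymPow.map_comp, hg, SymPow.map_id]
  intro x y hxy
  have h1 := LinearMap.congr_fun h x
  have h2 := LinearMap.congr_fun h y
  simp only [LinearMap.comp_apply, LinearMap.id_apply] at h1 h2
  rw [← h1, ← h2, hxy]

theorem SymPow.range_map_le (p : ℕ) (f : V →ₗ[K] W) :
    LinearMap.range (SymPow.map K p f) ≤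
      LinearMap.range (SymPow.map K p (LinearMap.range f).subtype) := by
  have : f = (LinearMap.range f).subtype ∘ₗ f.rangeRestrict := rfl
  conv_lhs => rw [this, SymPow.map_comp]
  exact LinearMap.range_comp_le_range _ _

theorem SymPow.range_map_eq (p : ℕ) (f : V →ₗ[K] W) :
    LinearMap.range (SymPow.map K p f) =
      LinearMap.range (SymPow.map K p (LinearMap.range f).subtype) := by
  refine le_antisymm (SymPow.range_map_le K p f) ?_
  obtain ⟨s, hs⟩ := LinearMap.exists_rightInverse_of_surjective f.rangeRestrict
    (LinearMap.range_rangeRestrict f)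
  have : (LinearMap.range f).subtype = f ∘ₗ s := by
    ext x
    have := congrArg Subtype.val (LinearMap.congr_fun hs x)
    simpa using this.symm
  rw [this, SymPow.map_comp]
  exact LinearMap.range_comp_le_range _ _

/-- `S^p (g + t h)` is a polynomial in `t` of degree `p`, with leading coefficient `S^p h`. -/
theorem SymPow.map_add_smul (p : ℕ) (g h : V →ₗ[K] W) :
    ∃ G : ℕ → (SymPow K V p →ₗ[K] SymPow K W p), G p = SymPow.map K p h ∧
      ∀ t : K, SymPow.map K p (g + t • h) = ∑ k ∈ Finset.range (p + 1), t ^ k • G k := by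
  classical
  obtain ⟨σ, hσ⟩ := LinearMap.exists_rightInverse_of_surjective (symRel K V p).mkQ
    (Submodule.range_mkQ _)
  let φ := PiTensorProduct.mapMultilinear K (fun _ : Fin p => V) (fun _ : Fin p => W)
  have hmap : ∀ f : V →ₗ[K] W,
      SymPow.map K p f = (symRel K W p).mkQ ∘ₗ (φ fun _ => f) ∘ₗ σ := by
    intro f
    refine LinearMap.ext fun x => ?_
    have hx : x = (symRel K V p).mkQ (σ x) := (LinearMap.congr_fun hσ x).symm
    conv_lhs => rw [hx]
    rfl
  let T : Finset (Fin p) → (SymPow K V p →ₗ[K] SymPow K W p) := fun s =>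
    (symRel K W p).mkQ ∘ₗ (φ (s.piecewise (fun _ => h) (fun _ => g))) ∘ₗ σ
  refine ⟨fun k => ∑ s : Finset (Fin p) with s.card = k, T s, ?_, ?_⟩
  · have : (Finset.univ.filter fun s : Finset (Fin p) => s.card = p) = {Finset.univ} := by
      ext s
      simp only [Finset.mem_filter, Finset.mem_univ, true_and, Finset.mem_singleton]
      rw [← Finset.card_eq_iff_eq_univ, Fintype.card_fin]
    simp only [this, Finset.sum_singleton, T, Finset.piecewise_univ]
    exact (hmap h).symm
  · intro t
    have h1 : φ (fun _ => g + t • h) = ∑ s : Finset (Fin p), t ^ s.card •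
        φ (s.piecewise (fun _ => h) (fun _ => g)) := by
      have h2 := φ.map_add_univ (fun _ => t • h) (fun _ => g)
      have h3 : ((fun _ => t • h) + (fun _ => g) : Fin p → (V →ₗ[K] W)) = fun _ => g + t • h := by
        ext1 i; exact add_comm _ _
      rw [h3] at h2
      rw [h2]
      refine Finset.sum_congr rfl fun s _ => ?_
      have h4 := φ.map_piecewise_smul (fun _ => t) (s.piecewise (fun _ => h) (fun _ => g)) s
      rw [Finset.prod_const] at h4
      rw [← h4]
      congr 1
      ext1 i
      by_cases hi : i ∈ s <;> simp [hi]
    rw [hmap, h1]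
    have h5 : ((symRel K W p).mkQ ∘ₗ (∑ s : Finset (Fin p), t ^ s.card •
        φ (s.piecewise (fun _ => h) (fun _ => g))) ∘ₗ σ) =
        ∑ s : Finset (Fin p), t ^ s.card • T s := by
      refine LinearMap.ext fun x => ?_
      simp only [T, LinearMap.comp_apply, LinearMap.sum_apply, LinearMap.smul_apply, map_sum,
        map_smul]
    rw [h5, ← Finset.sum_fiberwise_of_maps_to (s := Finset.univ) (t := Finset.range (p + 1))
      (g := Finset.card)]
    · refine Finset.sum_congr rfl fun k _ => ?_
      rw [Finset.smul_sum]
      refine Finset.sum_congr rfl fun s hs => ?_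
      rw [(Finset.mem_filter.mp hs).2]
    · intro s _
      rw [Finset.mem_range, Nat.lt_succ_iff]
      simpa using s.card_le_univ

theorem symPw_mem (p : ℕ) (f : U →ₗ[K] K) (e : U) (y : SymPow K U p) :
    ∃ c : K, SymPow.map K p (f.smulRight e) y = c • symPw K p e := by
  obtain ⟨x, rfl⟩ := (symRel K U p).mkQ_surjective y
  induction x using PiTensorProduct.induction_on with
  | smul_tprod r v =>
    refine ⟨r * ∏ i, f (v i), ?_⟩
    rw [SymPow.map_mk, map_smul, map_smul, PiTensorProduct.map_tprod, symPw, mul_smul,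
      ← map_smul _ (∏ i, f (v i)), ← MultilinearMap.map_smul_univ]
    rfl
  | add a b ha hb =>
    obtain ⟨c, hc⟩ := ha
    obtain ⟨c', hc'⟩ := hb
    exact ⟨c + c', by rw [map_add, map_add, hc, hc', add_smul]⟩

theorem MultilinearMap.eq_zero_of_diag [CharZero K] (p : ℕ)
    (m : MultilinearMap K (fun _ : Fin p => V) W)
    (hsymm : ∀ (σ : Equiv.Perm (Fin p)) v, m (fun i => v (σ i)) = m v)
    (hdiag : ∀ v, m (fun _ => v) = 0) : m = 0 := by
  classical
  ext v
  have h1 : ∀ s : Finset (Fin p), m (fun _ => ∑ j ∈ s, v j) =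
      ∑ r : Fin p → Fin p, if ∀ i, r i ∈ s then m (fun i => v (r i)) else 0 := by
    intro s
    rw [m.map_sum_finset (fun _ j => v j) (fun _ => s), ← Finset.sum_filter]
    refine Finset.sum_congr ?_ fun _ _ => rfl
    ext r; simp
  have h2 : ∑ s : Finset (Fin p), (-1 : K) ^ s.card • m (fun _ => ∑ j ∈ s, v j) = 0 :=
    Finset.sum_eq_zero fun s _ => by rw [hdiag, smul_zero]
  simp_rw [h1, Finset.smul_sum] at h2
  rw [Finset.sum_comm] at h2
  have h3 : ∀ r : Fin p → Fin p, (∑ s : Finset (Fin p), (-1 : K) ^ s.card •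
      (if ∀ i, r i ∈ s then m (fun i => v (r i)) else 0)) =
      if Function.Bijective r then (-1 : K) ^ p • m v else 0 := by
    intro r
    split_ifs with hr
    · rw [Finset.sum_eq_single Finset.univ]
      · simp only [Finset.mem_univ, implies_true, if_true, Finset.card_univ, Fintype.card_fin]
        congr 1
        exact hsymm (Equiv.ofBijective r hr) v
      · intro s _ hs
        rw [if_neg, smul_zero]
        intro h
        apply hs
        ext j
        obtain ⟨i, rfl⟩ := hr.2 j
        simp [h i]
      · simp
    · have hr' : ¬ Function.Surjective r := fun h => hr (Finite.surjective_iff_bijective.mp h)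
      rw [Function.Surjective] at hr'
      push Not at hr'
      obtain ⟨j, hj⟩ := hr'
      have hmem : ∀ (s : Finset (Fin p)), (∀ i, r i ∈ insert j s) ↔ ∀ i, r i ∈ s := by
        intro s
        simp [hj]
      have hmem' : ∀ (s : Finset (Fin p)), (∀ i, r i ∈ s.erase j) ↔ ∀ i, r i ∈ s := by
        intro s
        simp [hj]
      refine Finset.sum_involution (fun s _ => if j ∈ s then s.erase j else insert j s) ?_ ?_ ?_ ?_
      · intro s _
        by_cases h : j ∈ s
        · have hc := Finset.card_erase_add_one h
          simp only [h, if_true, hmem']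
          rw [← hc, ← add_smul, pow_succ]; simp
        · simp only [h, if_false, hmem]
          rw [Finset.card_insert_of_notMem h, ← add_smul, pow_succ]; simp
      · intro s _ _
        by_cases h : j ∈ s
        · simp [h]
        · simp [h]
      · intro s _; simp
      · intro s _
        by_cases h : j ∈ s <;> simp [h, Finset.insert_erase]
  simp_rw [h3] at h2
  rw [← Finset.sum_filter, Finset.sum_const, ← Nat.cast_smul_eq_nsmul K, smul_smul] at h2
  rw [smul_eq_zero] at h2
  rcases h2 with h2 | h2
  · exfalso
    rw [mul_eq_zero] at h2
    rcases h2 with h2 | h2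
    · rw [Nat.cast_eq_zero, Finset.card_eq_zero] at h2
      have : (id : Fin p → Fin p) ∈ (∅ : Finset (Fin p → Fin p)) := by
        rw [← h2, Finset.mem_filter]; exact ⟨Finset.mem_univ _, Function.bijective_id⟩
      simp at this
    · exact absurd h2 (pow_ne_zero _ (by simp))
  · simpa using h2

theorem SymPow.ext_symPw [CharZero K] (p : ℕ) (f : SymPow K V p →ₗ[K] W)
    (hf : ∀ v, f (symPw K p v) = 0) : f = 0 := by
  have h := MultilinearMap.eq_zero_of_diag K p
    ((f ∘ₗ (symRel K V p).mkQ).compMultilinearMap (PiTensorProduct.tprod K)) ?_ hf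
  · refine LinearMap.ext fun x => ?_
    obtain ⟨x, rfl⟩ := (symRel K V p).mkQ_surjective x
    have : f ∘ₗ (symRel K V p).mkQ = 0 := by
      apply PiTensorProduct.ext
      rw [h]; ext; simp
    exact LinearMap.congr_fun this x
  · intro σ v
    simp only [LinearMap.compMultilinearMap_apply, LinearMap.comp_apply]
    congr 1
    symm
    apply (Submodule.Quotient.eq _).2
    refine Submodule.mem_iSup_of_mem σ ⟨PiTensorProduct.tprod K (fun i => v (σ i)), ?_⟩
    rw [LinearMap.sub_apply, LinearEquiv.coe_coe, PiTensorProduct.reindex_tprod]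
    simp

end SymHelpers
section MainHelpers

open Module

variable {V U Q : Type*} [AddCommGroup V] [Module K V] [AddCommGroup U] [Module K U]
  [AddCommGroup Q] [Module K Q]

theorem comp_map_injective (p r : ℕ) (β : SymPow K V p →ₗ[K] Q)
    (hβ : ∀ X : Submodule K V, finrank K X = r →
      Disjoint (LinearMap.range (SymPow.map K p X.subtype)) (LinearMap.ker β))
    (hU : finrank K U = r) (g : U →ₗ[K] V) (hg : Function.Injective g) :
    Function.Injective (β ∘ₗ SymPow.map K p g) := by
  rw [← LinearMap.ker_eq_bot, LinearMap.ker_eq_bot']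
  intro y hy
  have h1 := hβ (LinearMap.range g) (by rw [LinearMap.finrank_range_of_inj hg, hU])
  rw [← SymPow.range_map_eq, Submodule.disjoint_def] at h1
  have h2 := h1 (SymPow.map K p g y) ⟨y, rfl⟩ hy
  exact SymPow.map_injective K p g hg (h2.trans (map_zero _).symm)

theorem key_pair [IsAlgClosed K] [FiniteDimensional K U] [FiniteDimensional K Q]
    (p r : ℕ) (α β : SymPow K V p →ₗ[K] Q)
    (hβ : ∀ X : Submodule K V, finrank K X = r →
      Disjoint (LinearMap.range (SymPow.map K p X.subtype)) (LinearMap.ker β))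
    (hαβ : ∀ X : Submodule K V, finrank K X = r →
      Submodule.map α (LinearMap.range (SymPow.map K p X.subtype)) ≤
        Submodule.map β (LinearMap.range (SymPow.map K p X.subtype)))
    (hU : finrank K U = r) (g h : U →ₗ[K] V) (hF : Function.Injective (LinearMap.coprod g h))
    (x : SymPow K U p) :
    ∃ y : SymPow K U p, β (SymPow.map K p g y) = α (SymPow.map K p g x) ∧
      β (SymPow.map K p h y) = α (SymPow.map K p h x) := by
  have hinj : ∀ t : K, Function.Injective (g + t • h) := by
    intro t u v huv
    have : LinearMap.coprod g h (u, t • u) = LinearMap.coprod g h (v, t • v) := by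
      simpa using huv
    exact (Prod.ext_iff.mp (hF this)).1
  have hinjh : Function.Injective h := by
    intro u v huv
    have : LinearMap.coprod g h (0, u) = LinearMap.coprod g h (0, v) := by
      simpa using huv
    exact (Prod.ext_iff.mp (hF this)).2
  obtain ⟨G, hGp, hG⟩ := SymPow.map_add_smul K p g h
  have hG0 : G 0 = SymPow.map K p g := by
    have := hG 0
    rw [zero_smul, add_zero, Finset.sum_range_succ'] at this
    simpa using this.symm
  have hsum : ∀ t : K, (∑ k ∈ Finset.range (p + 1), t ^ k • (β ∘ₗ G k)) =
      β ∘ₗ SymPow.map K p (g + t • h) := by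
    intro t
    rw [hG]
    refine LinearMap.ext fun z => ?_
    simp only [LinearMap.sum_apply, LinearMap.smul_apply, LinearMap.comp_apply, map_sum, map_smul]
  have hsum' : ∀ t : K, (∑ k ∈ Finset.range (p + 1), t ^ k • α (G k x)) =
      α (SymPow.map K p (g + t • h) x) := by
    intro t
    rw [hG]
    simp only [LinearMap.sum_apply, LinearMap.smul_apply, map_sum, map_smul]
  obtain ⟨y, hy0, hyp⟩ := linSolve (K := K) p (fun k => β ∘ₗ G k) (fun k => α (G k x))
    (fun t => by rw [hsum]; exact comp_map_injective K p r β hβ hU _ (hinj t))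
    (by rw [hGp]; exact comp_map_injective K p r β hβ hU _ hinjh)
    (fun t => by
      rw [hsum, hsum']
      have h1 := hαβ (LinearMap.range (g + t • h))
        (by rw [LinearMap.finrank_range_of_inj (hinj t), hU])
      rw [← SymPow.range_map_eq] at h1
      obtain ⟨z, ⟨y, rfl⟩, hz⟩ := h1 ⟨_, ⟨x, rfl⟩, rfl⟩
      exact ⟨y, hz⟩)
  refine ⟨y, ?_, ?_⟩
  · rw [← hG0]; exact hy0
  · rw [← hGp]; exact hyp

open Polynomial in
theorem poly_limit [Infinite K] {M : Type*} [AddCommGroup M] [Module K M] (N : ℕ) (a : ℕ → M)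
    (y : M) (h : ∀ t : K, t ≠ 0 → ∑ k ∈ Finset.range (N + 1), t ^ k • a k = y) : a 0 = y := by
  rw [← sub_eq_zero, ← Module.forall_dual_apply_eq_zero_iff K]
  intro l
  have h1 : (X : K[X]) * ((∑ k ∈ Finset.range (N + 1), C (l (a k)) * X ^ k) - C (l y)) = 0 := by
    apply Polynomial.funext
    intro t
    by_cases ht : t = 0
    · simp [ht]
    · have h2 := congrArg l (h t ht)
      simp only [map_sum, map_smul, smul_eq_mul] at h2
      rw [eval_mul, eval_sub, eval_finsetSum, eval_C, ← h2]
      simp only [eval_mul, eval_C, eval_pow, eval_X, eval_zero]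
      rw [mul_eq_zero, sub_eq_zero]
      right
      exact Finset.sum_congr rfl fun k _ => mul_comm _ _
  have h3 := (mul_eq_zero.mp h1).resolve_left X_ne_zero
  have h4 := congrArg (eval 0) h3
  rw [eval_sub, eval_finsetSum, Finset.sum_range_succ'] at h4
  simpa using h4

theorem key_scalar [IsAlgClosed K] [FiniteDimensional K U] [FiniteDimensional K Q]
    (p r : ℕ) (α β : SymPow K V p →ₗ[K] Q)
    (hβ : ∀ X : Submodule K V, finrank K X = r →
      Disjoint (LinearMap.range (SymPow.map K p X.subtype)) (LinearMap.ker β))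
    (hαβ : ∀ X : Submodule K V, finrank K X = r →
      Submodule.map α (LinearMap.range (SymPow.map K p X.subtype)) ≤
        Submodule.map β (LinearMap.range (SymPow.map K p X.subtype)))
    (hU : finrank K U = r) (g h : U →ₗ[K] V) (hF : Function.Injective (LinearMap.coprod g h))
    (e : U) (f : U →ₗ[K] K) (hfe : f e = 1) :
    ∃ c : K, α (symPw K p (g e)) = c • β (symPw K p (g e)) ∧
      α (symPw K p (h e)) = c • β (symPw K p (h e)) := by
  have hinf : Infinite K := IsAlgClosed.instInfinite
  obtain ⟨y, hyg, hyh⟩ := key_pair K p r α β hβ hαβ hU g h hF (symPw K p e)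
  have hinjg : Function.Injective g := by
    intro u v huv
    have : LinearMap.coprod g h (u, 0) = LinearMap.coprod g h (v, 0) := by
      simpa using huv
    exact (Prod.ext_iff.mp (hF this)).1
  have hinjh : Function.Injective h := by
    intro u v huv
    have : LinearMap.coprod g h (0, u) = LinearMap.coprod g h (0, v) := by
      simpa using huv
    exact (Prod.ext_iff.mp (hF this)).2
  let π : U →ₗ[K] U := f.smulRight e
  let δ : K → (U →ₗ[K] U) := fun t => π + t • (LinearMap.id - π)
  have hδe : ∀ t, δ t e = e := by
    intro t
    simp [δ, π, hfe]
  have hfδ : ∀ t u, f (δ t u) = f u := by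
    intro t u
    simp [δ, π, hfe]
  have hδinj : ∀ t, t ≠ 0 → Function.Injective (δ t) := by
    intro t ht
    rw [← LinearMap.ker_eq_bot, LinearMap.ker_eq_bot']
    intro u hu
    have h1 : f u = 0 := by rw [← hfδ t u, hu, map_zero]
    have h2 : t • u = 0 := by
      simpa [δ, π, h1] using hu
    exact (smul_eq_zero.mp h2).resolve_left ht
  have hfix : ∀ t, t ≠ 0 → SymPow.map K p (δ t) y = y := by
    intro t ht
    have hF' : Function.Injective (LinearMap.coprod (g ∘ₗ δ t) h) := by
      intro u v huv
      have : LinearMap.coprod g h (δ t u.1, u.2) = LinearMap.coprod g h (δ t v.1, v.2) := by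
        simpa using huv
      have := Prod.ext_iff.mp (hF this)
      exact Prod.ext (hδinj t ht this.1) this.2
    obtain ⟨z, hzg, hzh⟩ := key_pair K p r α β hβ hαβ hU (g ∘ₗ δ t) h hF' (symPw K p e)
    have hzy : z = y := comp_map_injective K p r β hβ hU h hinjh (hzh.trans hyh.symm)
    subst hzy
    rw [SymPow.map_comp, LinearMap.comp_apply, LinearMap.comp_apply, SymPow.map_symPw K p (δ t),
      hδe, ← hyg] at hzg
    exact comp_map_injective K p r β hβ hU g hinjg hzg
  obtain ⟨G, -, hG⟩ := SymPow.map_add_smul K p π (LinearMap.id - π)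
  have hG0 : G 0 = SymPow.map K p π := by
    have := hG 0
    rw [zero_smul, add_zero, Finset.sum_range_succ'] at this
    simpa using this.symm
  have hlim : G 0 y = y := by
    refine poly_limit K p (fun k => G k y) y fun t ht => ?_
    have h1 := hfix t ht
    simp only [δ] at h1
    rw [hG] at h1
    simpa only [LinearMap.sum_apply, LinearMap.smul_apply] using h1
  obtain ⟨c, hc⟩ := symPw_mem K p f e y
  have hy : y = c • symPw K p e := by
    rw [hG0] at hlim
    exact hlim.symm.trans hc
  refine ⟨c, ?_, ?_⟩
  · rw [hy, map_smul, map_smul, SymPow.map_symPw] at hyg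
    exact hyg.symm
  · rw [hy, map_smul, map_smul, SymPow.map_symPw] at hyh
    exact hyh.symm

theorem exists_pair [FiniteDimensional K V] (d : ℕ) (hV : 2 * d + 2 ≤ finrank K V) (u v : V)
    (huv : LinearIndependent K ![u, v]) :
    ∃ g h : (K × (Fin d → K)) →ₗ[K] V, Function.Injective (LinearMap.coprod g h) ∧
      g (1, 0) = u ∧ h (1, 0) = v := by
  obtain ⟨C, hC⟩ := Submodule.exists_isCompl (Submodule.span K (Set.range ![u, v]))
  have hdim := Submodule.finrank_add_eq_of_isCompl hC
  rw [finrank_span_eq_card huv, Fintype.card_fin] at hdim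
  have hle : finrank K ((Fin d → K) × (Fin d → K)) ≤ finrank K C := by
    rw [finrank_prod, finrank_fin_fun]; omega
  obtain ⟨j, hj⟩ : ∃ j : ((Fin d → K) × (Fin d → K)) →ₗ[K] C, Function.Injective j := by
    exact finrank_le_iff_exists_linearMap.mp hle
  let g : (K × (Fin d → K)) →ₗ[K] V :=
    LinearMap.coprod (LinearMap.toSpanSingleton K V u) (C.subtype ∘ₗ j ∘ₗ LinearMap.inl K _ _)
  let h : (K × (Fin d → K)) →ₗ[K] V :=
    LinearMap.coprod (LinearMap.toSpanSingleton K V v) (C.subtype ∘ₗ j ∘ₗ LinearMap.inr K _ _)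
  refine ⟨g, h, ?_, ?_, ?_⟩
  · rw [← LinearMap.ker_eq_bot, LinearMap.ker_eq_bot']
    rintro ⟨⟨s, x⟩, ⟨t, y⟩⟩ hz
    have h1 : (s • u + t • v) + (j (x, y) : V) = 0 := by
      have : (x, y) = (x, 0) + (0, y) := by simp
      rw [this, map_add]
      simp only [g, h, LinearMap.coprod_apply, LinearMap.toSpanSingleton_apply,
        LinearMap.comp_apply, LinearMap.inl_apply, LinearMap.inr_apply, Submodule.subtype_apply]
        at hz
      rw [← hz, Submodule.coe_add]
      abel
    have hmem : s • u + t • v ∈ Submodule.span K (Set.range ![u, v]) := by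
      refine add_mem (Submodule.smul_mem _ _ (Submodule.subset_span ⟨0, rfl⟩))
        (Submodule.smul_mem _ _ (Submodule.subset_span ⟨1, rfl⟩))
    have hzero : s • u + t • v = 0 := by
      refine (Submodule.disjoint_def.mp hC.disjoint) _ hmem ?_
      rw [eq_neg_of_add_eq_zero_left h1]
      exact neg_mem (j (x, y)).2
    rw [hzero, zero_add] at h1
    have h2 : (x, y) = 0 := hj (by rw [map_zero]; exact Subtype.ext h1)
    have h3 := LinearIndependent.pair_iff.mp huv s t hzero
    obtain ⟨hx, hy⟩ := Prod.mk_eq_zero.mp h2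
    simp [hx, hy, h3.1, h3.2]
  · simp [g, Prod.mk_zero_zero]
  · simp [h, Prod.mk_zero_zero]

theorem main_scalar [IsAlgClosed K] [CharZero K] [FiniteDimensional K V] [FiniteDimensional K Q]
    (p d : ℕ) (hV : 2 * d + 2 ≤ finrank K V) (α β : SymPow K V p →ₗ[K] Q)
    (hβ : ∀ X : Submodule K V, finrank K X = d + 1 →
      Disjoint (LinearMap.range (SymPow.map K p X.subtype)) (LinearMap.ker β))
    (hαβ : ∀ X : Submodule K V, finrank K X = d + 1 →
      Submodule.map α (LinearMap.range (SymPow.map K p X.subtype)) ≤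
        Submodule.map β (LinearMap.range (SymPow.map K p X.subtype))) :
    ∃ c : K, α = c • β := by
  have hpair : ∀ u v : V, LinearIndependent K ![u, v] →
      ∃ c : K, α (symPw K p u) = c • β (symPw K p u) ∧
        α (symPw K p v) = c • β (symPw K p v) := by
    intro u v huv
    obtain ⟨g, h, hF, rfl, rfl⟩ := exists_pair K d hV u v huv
    exact key_scalar K p (d + 1) α β hβ hαβ (by simp [add_comm]) g h hF (1, 0)
      (LinearMap.fst K K _) rfl
  let b := finBasis K V
  let u := b ⟨0, by omega⟩
  have hu : u ≠ 0 := b.ne_zero _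
  have hu1 : LinearIndependent K ![u, b ⟨1, by omega⟩] := by
    have := b.linearIndependent.comp ![⟨0, by omega⟩, ⟨1, by omega⟩] (by
      intro i j hij
      fin_cases i <;> fin_cases j <;> simp_all)
    convert this using 1
    ext i
    fin_cases i <;> rfl
  obtain ⟨c, hc, -⟩ := hpair _ _ hu1
  refine ⟨c, ?_⟩
  rw [← sub_eq_zero]
  apply SymPow.ext_symPw
  intro v
  rw [LinearMap.sub_apply, LinearMap.smul_apply, sub_eq_zero]
  by_cases h0 : β (symPw K p u) = 0
  · -- degenerate case
    obtain ⟨g, h, hF, hg, -⟩ := exists_pair K d hV _ _ hu1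
    have hinjg : Function.Injective g := by
      intro u v huv
      have : LinearMap.coprod g h (u, 0) = LinearMap.coprod g h (v, 0) := by
        simpa using huv
      exact (Prod.ext_iff.mp (hF this)).1
    have h1 : symPw K p ((1, 0) : K × (Fin d → K)) = 0 := by
      apply comp_map_injective K p (d + 1) β hβ (by simp [add_comm]) g hinjg
      rw [LinearMap.comp_apply, SymPow.map_symPw, hg, h0, map_zero]
    have h2 : symPw K p v = 0 := by
      have := SymPow.map_symPw K p
        ((LinearMap.toSpanSingleton K V v) ∘ₗ (LinearMap.fst K K (Fin d → K))) (1, 0)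
      rw [h1, map_zero] at this
      simpa using this.symm
    rw [h2, map_zero, map_zero, smul_zero]
  · by_cases hli : LinearIndependent K ![u, v]
    · obtain ⟨c', hcu, hcv⟩ := hpair u v hli
      have : c' = c := smul_left_injective K h0 (hcu.symm.trans hc)
      rw [hcv, this]
    · rw [LinearIndependent.pair_iff' hu] at hli
      push Not at hli
      obtain ⟨s, rfl⟩ := hli
      have := SymPow.map_symPw K p (s • (LinearMap.id : V →ₗ[K] V)) u
      have hpow : symPw K p (s • u) = s ^ p • symPw K p u := by
        have h3 := (PiTensorProduct.tprod K).map_smul_univ (fun _ : Fin p => s) (fun _ => u)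
        rw [Finset.prod_const, Finset.card_univ, Fintype.card_fin] at h3
        rw [symPw, symPw, h3, map_smul]
      rw [hpow, map_smul, map_smul, hc, smul_comm]

end MainHelpers

open Module

/-- Let `H, H'` be subspaces of `S^p V` (`p ≥ 2`, `1 ≤ d ≤ n-d-1`,
`dim V = n+1`) such that the bundle morphisms `f_H : S^p R → O_G ⊗ (S^p V/H)` and
`f_{H'}` on `G(d,n)` are injective — fiberwise: for every `(d+1)`-dimensional `X ⊆ V` the
image of `S^p X` in `S^p V` meets `H` (resp. `H'`) only in `0`.  If the quotient bundles
`E_H` and `E_{H'}` are isomorphic, then `H = H'`.  A bundle isomorphism `E_H ≅ E_{H'}`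
induces (via `H⁰(G, E_H) = S^p V/H`) a linear isomorphism `ψ : S^p V/H ≅ S^p V/H'`
carrying, for every fiber, the image of `S^p X` in `S^p V/H` onto its image in
`S^p V/H'`; we take this induced data as the formal meaning of `E_H ≅ E_{H'}`. -/
theorem stmt11 (V : Type*) [IsAlgClosed K] [CharZero K]
    [AddCommGroup V] [Module K V] [FiniteDimensional K V]
    (n d p : ℕ) (hV : finrank K V = n + 1) (hd1 : 1 ≤ d) (hd2 : d ≤ n - d - 1)
    (hp : 2 ≤ p)
    (H H' : Submodule K (SymPow K V p))
    (hH : ∀ X : Submodule K V, finrank K X = d + 1 →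
      Disjoint (LinearMap.range (SymPow.map K p X.subtype)) H)
    (hH' : ∀ X : Submodule K V, finrank K X = d + 1 →
      Disjoint (LinearMap.range (SymPow.map K p X.subtype)) H')
    (ψ : (SymPow K V p ⧸ H) ≃ₗ[K] (SymPow K V p ⧸ H'))
    (hψ : ∀ X : Submodule K V, finrank K X = d + 1 →
      Submodule.map ψ.toLinearMap
          (Submodule.map H.mkQ (LinearMap.range (SymPow.map K p X.subtype))) =
        Submodule.map H'.mkQ (LinearMap.range (SymPow.map K p X.subtype))) :
    H = H' := by
  have hdim : 2 * d + 2 ≤ finrank K V := by omega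
  obtain ⟨c, hc⟩ := main_scalar K p d hdim (ψ.toLinearMap ∘ₗ H.mkQ) H'.mkQ
    (fun X hX => by rw [Submodule.ker_mkQ]; exact hH' X hX)
    (fun X hX => by rw [Submodule.map_comp, hψ X hX])
  have hk : LinearMap.ker (ψ.toLinearMap ∘ₗ H.mkQ) = H := by
    rw [LinearEquiv.ker_comp, Submodule.ker_mkQ]
  have hk' : LinearMap.ker H'.mkQ = H' := Submodule.ker_mkQ H'
  by_cases h0 : c = 0
  · rw [h0, zero_smul] at hc
    have hsurj : Function.Surjective (ψ.toLinearMap ∘ₗ H.mkQ) :=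
      ψ.surjective.comp H.mkQ_surjective
    rw [hc] at hsurj hk
    rw [← hk, ← hk', LinearMap.ker_zero]
    symm
    rw [LinearMap.ker_eq_top]
    refine LinearMap.ext fun x => ?_
    obtain ⟨y, hy⟩ := hsurj (H'.mkQ x)
    rw [← hy]
    rfl
  · rw [← hk, hc, LinearMap.ker_smul _ _ h0, hk']
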